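/- Let q = p^h with p an odd prime. Then for every integer n with 1 < n < q there is no set B of points of PG(2,q) with |B| = (n−1)(q+1) + 1 = nq − q + n such that every line of PG(2,q) contains at most n points of B. In other words, PG(2,q) contains no maximal arc when q is odd. -/

import Mathlib

open Module

namespace MaximalArc

open Polynomial

section Coefficients

variable {R : Type*} [CommRing R]

lemma coeff_pow_prime_pow_eq_zero (p k : ℕ) [hp : Fact p.Prime] [CharP R p] (f : R[X]) {i : ℕ}
    (hi : ¬ p ^ k ∣ i) : (f ^ p ^ k).coeff i = 0 := by
  rw [← map_iterateFrobenius_expand p f k, coeff_map, coeff_expand (pow_pos hp.out.pos k), if_neg hi,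
    map_zero]

lemma coeff_mul_eq_zero_of_not_dvd {n : ℕ} {f g : R[X]} (hf : ∀ i, ¬ n ∣ i → f.coeff i = 0)
    (hg : ∀ i, ¬ n ∣ i → g.coeff i = 0) {i : ℕ} (hi : ¬ n ∣ i) : (f * g).coeff i = 0 := by
  rw [coeff_mul]
  refine Finset.sum_eq_zero fun x hx => ?_
  rw [Finset.HasAntidiagonal.mem_antidiagonal] at hx
  by_cases h1 : n ∣ x.1
  · have h2 : ¬ n ∣ x.2 := fun h2 => hi (hx ▸ dvd_add h1 h2)
    rw [hg _ h2, mul_zero]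
  · rw [hf _ h1, zero_mul]

/-- If the product of `g` with a series `f = 1 + ⋯` in `X ^ n` agrees up to degree `m` with a
series in `X ^ n`, then so does `g`. -/
lemma coeff_eq_zero_of_coeff_mul_eq_zero {n m : ℕ} {f g : R[X]} (hf0 : f.coeff 0 = 1)
    (hf : ∀ i, ¬ n ∣ i → f.coeff i = 0) (hfg : ∀ i ≤ m, ¬ n ∣ i → (f * g).coeff i = 0) :
    ∀ i ≤ m, ¬ n ∣ i → g.coeff i = 0 := by
  intro i
  induction i using Nat.strong_induction_on with
  | _ i ih =>
    intro him hi
    have h := hfg i him hi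
    rw [coeff_mul, Finset.sum_eq_single (0, i), hf0, one_mul] at h
    · exact h
    · rintro ⟨x, y⟩ hx hne
      rw [Finset.HasAntidiagonal.mem_antidiagonal] at hx
      simp only at hx ⊢
      by_cases h1 : n ∣ x
      · have h2 : ¬ n ∣ y := fun h2 => hi (hx ▸ dvd_add h1 h2)
        have hx0 : x ≠ 0 := by
          rintro rfl
          exact hne (by simp at hx; simp [hx])
        rw [ih y (by omega) (by omega) h2, mul_zero]
      · rw [hf _ h1, zero_mul]
    · simp

lemma coeff_eq_of_one_sub_X_pow_mul {n N : ℕ} (hn : 1 < n) (hN : n ∣ N - 1) (hN0 : 0 < N)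
    {f g P : R[X]} {c : R} (hf : ∀ i, ¬ n ∣ i → f.coeff i = 0)
    (hP : ∀ i, ¬ n ∣ i → P.coeff i = 0) (hg : g.natDegree ≤ (n - 1) * N + 1)
    (h : (1 - X ^ N) * g = - (f * (P + C c * X ^ N))) :
    g.coeff n = c * f.coeff n := by
  have hmod : ∀ j, n ∣ n + j * N ↔ n ∣ j := by
    intro j
    obtain ⟨t, ht⟩ := hN
    have : n + j * N = j + n * (1 + j * t) := by
      obtain rfl : N = n * t + 1 := by omega
      ring
    rw [this, Nat.dvd_add_left (dvd_mul_right _ _)]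
  have step : ∀ j, ¬ n ∣ j + 1 →
      g.coeff (n + (j + 1) * N) = g.coeff (n + j * N) - c * f.coeff (n + j * N) := by
    intro j hj
    have h1 := congrArg (fun F => coeff F (n + (j + 1) * N)) h
    have h2 : n + (j + 1) * N = (n + j * N) + N := by ring
    have h3 : (f * P).coeff (n + (j + 1) * N) = 0 :=
      coeff_mul_eq_zero_of_not_dvd hf hP (by rwa [hmod])
    simp only [sub_mul, one_mul, mul_add, neg_add, coeff_sub, coeff_add, coeff_neg, h3] at h1
    rw [h2, mul_comm (X ^ N) g, coeff_mul_X_pow, ← mul_assoc, coeff_mul_X_pow, mul_comm f,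
      coeff_C_mul] at h1
    rw [h2]
    linear_combination h1
  have tele : ∀ j, j + 1 < n → g.coeff (n + (j + 1) * N) = g.coeff n - c * f.coeff n := by
    intro j
    induction j with
    | zero =>
      intro hj
      have := step 0 (by simp; omega)
      simpa using this
    | succ j ih =>
      intro hj
      rw [step (j + 1) (Nat.not_dvd_of_pos_of_lt (by omega) (by omega)), ih (by omega),
        hf (n + (j + 1) * N), mul_zero, sub_zero]
      rw [hmod]
      exact Nat.not_dvd_of_pos_of_lt (by omega) (by omega)
  have h1 := tele (n - 2) (by omega)
  rw [show n - 2 + 1 = n - 1 by omega, coeff_eq_zero_of_natDegree_lt (by omega)] at h1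
  linear_combination -h1

end Coefficients

section CoefficientwiseDerivative

variable {R : Type*} [CommRing R]

/-- The derivation of `R[X][Y]` that differentiates the coefficients. -/
noncomputable def coeffDerivative (f : R[X][X]) : R[X][X] :=
  ∑ i ∈ f.support, monomial i (derivative (f.coeff i))

@[simp]
lemma coeff_coeffDerivative (f : R[X][X]) (i : ℕ) :
    (coeffDerivative f).coeff i = derivative (f.coeff i) := by
  simp only [coeffDerivative, finsetSum_coeff, coeff_monomial, Finset.sum_ite_eq']
  split_ifs with h
  · rfl
  · rw [notMem_support_iff.mp h, derivative_zero]

lemma coeffDerivative_mul (f g : R[X][X]) :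
    coeffDerivative (f * g) = coeffDerivative f * g + f * coeffDerivative g := by
  ext1 i
  simp [coeff_mul, derivative_mul, Finset.sum_add_distrib]

lemma natDegree_coeffDerivative_le (f : R[X][X]) : (coeffDerivative f).natDegree ≤ f.natDegree :=
  natDegree_le_iff_coeff_eq_zero.2 fun i hi => by
    rw [coeff_coeffDerivative, coeff_eq_zero_of_natDegree_lt hi, derivative_zero]

lemma coeffDerivative_one_sub (g : R[X]) :
    coeffDerivative (1 - C g * X) = - (C (derivative g) * X) := by
  ext1 i
  rw [coeff_coeffDerivative, coeff_sub, coeff_neg, coeff_C_mul, coeff_C_mul, coeff_one, coeff_X]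
  split_ifs <;> simp

lemma coeffDerivative_one : coeffDerivative (1 : R[X][X]) = 0 := by
  ext1 i
  rw [coeff_coeffDerivative, coeff_one]
  split_ifs <;> simp

lemma natDegree_coeff_prod_le {ι : Type*} (s : Finset ι) (g : ι → R[X]) {d : ℕ}
    (hg : ∀ b ∈ s, (g b).natDegree ≤ d) (k : ℕ) :
    ((∏ b ∈ s, (1 - C (g b) * X)).coeff k).natDegree ≤ k * d := by
  classical
  induction s using Finset.induction_on generalizing k with
  | empty =>
    simp only [Finset.prod_empty, coeff_one]
    split_ifs <;> simp
  | insert b s hb ih =>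
    rw [Finset.prod_insert hb, sub_mul, one_mul, coeff_sub]
    have ih' := ih fun b hb => hg b (Finset.mem_insert_of_mem hb)
    refine (natDegree_sub_le _ _).trans (max_le (ih' k) ?_)
    cases k with
    | zero => simp
    | succ k =>
      rw [mul_assoc, coeff_C_mul, coeff_X_mul, add_mul, one_mul, add_comm]
      exact natDegree_mul_le.trans (add_le_add (hg b (Finset.mem_insert_self _ _)) (ih' k))

lemma natDegree_prod_one_sub_le {ι : Type*} (s : Finset ι) (g : ι → R) :
    (∏ b ∈ s, (1 - C (g b) * X)).natDegree ≤ s.card := by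
  refine (natDegree_prod_le _ _).trans ((Finset.sum_le_card_nsmul _ _ 1 fun b _ => ?_).trans (by simp))
  exact (natDegree_sub_le _ _).trans (max_le (by simp) ((natDegree_C_mul_le _ _).trans natDegree_X_le))

end CoefficientwiseDerivative

section DirectionPolynomial

variable {K : Type*} [Field K]

/-- `∏ (1 - (1 - b x) ^ (q - 1) t)`, as a polynomial in `t` over `K[x]`. -/
noncomputable def directionPoly (q : ℕ) (S : Finset K) : K[X][X] :=
  ∏ b ∈ S, (1 - C ((1 - C b * X) ^ (q - 1)) * X)

/-- `∏ (1 - b x)`. -/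
noncomputable def pointPoly (S : Finset K) : K[X] := ∏ b ∈ S, (1 - C b * X)

lemma map_directionPoly (q : ℕ) (S : Finset K) (x : K) :
    (directionPoly q S).map (evalRingHom x) =
      ∏ b ∈ S, (1 - C ((1 - b * x) ^ (q - 1)) * X) := by
  simp [directionPoly, Polynomial.map_prod]

lemma eval_coeff_directionPoly (q : ℕ) (S : Finset K) (x : K) (k : ℕ) :
    ((directionPoly q S).coeff k).eval x =
      (∏ b ∈ S, (1 - C ((1 - b * x) ^ (q - 1)) * X)).coeff k := by
  rw [← map_directionPoly, coeff_map, coe_evalRingHom]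

lemma natDegree_coeff_directionPoly_le (q : ℕ) (S : Finset K) (k : ℕ) :
    ((directionPoly q S).coeff k).natDegree ≤ k * (q - 1) := by
  refine natDegree_coeff_prod_le _ _ (fun b _ => ?_) k
  refine natDegree_pow_le.trans ?_
  conv_rhs => rw [← mul_one (q - 1)]
  refine Nat.mul_le_mul_left _ ?_
  exact (natDegree_sub_le _ _).trans (max_le (by simp) ((natDegree_C_mul_le _ _).trans natDegree_X_le))

lemma coeff_zero_directionPoly (q : ℕ) (S : Finset K) : (directionPoly q S).coeff 0 = 1 := by
  simp [directionPoly, coeff_zero_prod]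

lemma eval_derivative_pointPoly (S : Finset K) {x : K} (hx : ∀ b ∈ S, 1 - b * x ≠ 0) :
    (derivative (pointPoly S)).eval x =
      -((∑ b ∈ S, b / (1 - b * x)) * (pointPoly S).eval x) := by
  classical
  unfold pointPoly
  induction S using Finset.induction_on with
  | empty => simp
  | insert b S hb ih =>
    have ih' := ih fun b hb => hx b (Finset.mem_insert_of_mem hb)
    have hbx := hx b (Finset.mem_insert_self _ _)
    rw [Finset.prod_insert hb, Finset.sum_insert hb, derivative_mul, eval_add, eval_mul, eval_mul,
      ih']
    simp only [derivative_sub, derivative_one, derivative_C_mul, derivative_X, eval_mul, eval_sub,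
      eval_one, eval_C, eval_X, mul_one, zero_sub, eval_neg]
    field_simp
    ring

lemma one_sub_X_pow_mul_map_coeffDerivative {q : ℕ} (hq : 1 < q) (hqK : (q : K) = 0) (S : Finset K)
    {x : K} (hx : ∀ b ∈ S, ((1 - b * x) ^ (q - 1)) ^ (q + 1) = 1) :
    (1 - X ^ (q + 1)) * (coeffDerivative (directionPoly q S)).map (evalRingHom x) =
      -((directionPoly q S).map (evalRingHom x) *
        ∑ b ∈ S, C (b / (1 - b * x)) *
          ∑ i ∈ Finset.range (q + 1), (C ((1 - b * x) ^ (q - 1)) * X) ^ (i + 1)) := by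
  classical
  unfold directionPoly
  induction S using Finset.induction_on with
  | empty => simp [coeffDerivative_one]
  | insert b S hb ih =>
    have ih' := ih fun b hb => hx b (Finset.mem_insert_of_mem hb)
    have hbx := hx b (Finset.mem_insert_self _ _)
    have hne : 1 - b * x ≠ 0 := by
      intro h0
      rw [h0, zero_pow (by omega), zero_pow (by omega)] at hbx
      exact zero_ne_one hbx
    rw [Finset.prod_insert hb, Finset.sum_insert hb, coeffDerivative_mul, Polynomial.map_add,
      Polynomial.map_mul, Polynomial.map_mul, Polynomial.map_mul, coeffDerivative_one_sub]
    set D := (coeffDerivative (∏ b ∈ S, (1 - C ((1 - C b * X) ^ (q - 1)) * X))).map (evalRingHom x)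
    set F := (∏ b ∈ S, (1 - C ((1 - C b * X) ^ (q - 1)) * X)).map (evalRingHom x)
    have hd : (derivative ((1 - C b * X) ^ (q - 1))).eval x
        = b / (1 - b * x) * (1 - b * x) ^ (q - 1) := by
      have hq1 : ((q - 1 : ℕ) : K) = -1 := by
        rw [Nat.cast_sub hq.le, hqK]
        simp
      obtain ⟨m, hm⟩ : ∃ m, q - 1 = m + 1 := ⟨q - 2, by omega⟩
      rw [derivative_pow]
      simp only [derivative_sub, derivative_one, derivative_C_mul, derivative_X, eval_mul, eval_sub,
        eval_one, eval_C, eval_X, mul_one, zero_sub, eval_neg, eval_pow, hq1]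
      rw [hm, Nat.add_sub_cancel, pow_succ]
      field_simp
    set u := (1 - b * x) ^ (q - 1) with hu
    have hgeom : (1 - C u * X) * ∑ i ∈ Finset.range (q + 1), (C u * X) ^ (i + 1)
        = (C u * X) * (1 - X ^ (q + 1)) := by
      have h1 := mul_neg_geom_sum (C u * X : K[X]) (q + 1)
      have h2 : (C u * X : K[X]) ^ (q + 1) = X ^ (q + 1) := by
        rw [mul_pow, ← C_pow, hbx, C_1, one_mul]
      rw [h2] at h1
      simp only [pow_succ', ← Finset.mul_sum] at h1 ⊢
      linear_combination (C u * X : K[X]) * h1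
    have e1 : (-(C (derivative ((1 - C b * X) ^ (q - 1))) * X)).map (evalRingHom x)
        = -(C (b / (1 - b * x)) * (C u * X)) := by
      simp only [Polynomial.map_neg, Polynomial.map_mul, map_C, map_X, coe_evalRingHom, hd, C_mul]
      ring
    have e2 : (1 - C ((1 - C b * X) ^ (q - 1)) * X).map (evalRingHom x) = 1 - C u * X := by
      simp [hu]
    rw [e1, e2]
    linear_combination (1 - C u * X) * ih' + F * C (b / (1 - b * x)) * hgeom

end DirectionPolynomial

section FieldLemmas

variable {K : Type*} [Field K]

lemma one_sub_mul_pow {x b : K} (hx : x ≠ 0) (m : ℕ) :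
    (1 - b * x) ^ m = (-x) ^ m * (b - x⁻¹) ^ m := by
  rw [← mul_pow]
  congr 1
  field_simp
  ring

lemma one_sub_mul_pow_eq_iff {x b w : K} (hx : x ≠ 0) (m : ℕ) :
    (1 - b * x) ^ m = w ↔ (b - x⁻¹) ^ m = w / (-x) ^ m := by
  rw [one_sub_mul_pow hx, eq_div_iff (pow_ne_zero _ (neg_ne_zero.2 hx)), mul_comm]

lemma eq_inv_of_one_sub_mul_eq_zero {b x : K} (h : 1 - b * x = 0) : x = b⁻¹ :=
  eq_inv_of_mul_eq_one_right (sub_eq_zero.1 h).symm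

lemma natDegree_pointPoly {S : Finset K} (h0 : (0 : K) ∉ S) : (pointPoly S).natDegree = S.card := by
  have h1 : ∀ b ∈ S, (1 - C b * X : K[X]).natDegree = 1 := fun b hb => by
    have hb0 : -b ≠ 0 := neg_ne_zero.2 fun h => h0 (h ▸ hb)
    have := natDegree_linear (b := (1 : K)) hb0
    rwa [C_neg, C_1, neg_mul, neg_add_eq_sub] at this
  rw [pointPoly, natDegree_prod, Finset.sum_congr rfl h1]
  · simp
  · intro b hb h
    have := h1 b hb
    simp [h] at this

lemma isCoprime_one_sub {b c : K} (hbc : b ≠ c) : IsCoprime (1 - C b * X) (1 - C c * X) := by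
  have h : c - b ≠ 0 := sub_ne_zero.2 hbc.symm
  refine ⟨C (c / (c - b)), -C (b / (c - b)), ?_⟩
  have h1 : (C (c / (c - b)) - C (b / (c - b)) : K[X]) = 1 := by
    rw [← C_sub, ← sub_div, div_self h, C_1]
  have h2 : (C (c / (c - b)) * C b - C (b / (c - b)) * C c : K[X]) = 0 := by
    rw [← C_mul, ← C_mul, ← C_sub]
    simp only [C_eq_zero]
    ring
  linear_combination h1 - X * h2

lemma separable_pointPoly (S : Finset K) : (pointPoly S).Separable := by
  refine separable_prod' (fun b _ c _ hbc => isCoprime_one_sub hbc) fun b _ => ?_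
  rw [separable_def]
  refine ⟨1, -X, ?_⟩
  simp

variable [Fintype K] [DecidableEq K]

lemma card_filter_pow_eq_one_le (N : ℕ) (hN : 0 < N) :
    (Finset.univ.filter fun w : K => w ^ N = 1).card ≤ N := by
  refine le_trans (Finset.card_le_card fun w hw => ?_)
    ((Multiset.toFinset_card_le _).trans (card_nthRoots N (1 : K)))
  rw [Multiset.mem_toFinset, mem_nthRoots hN]
  simpa using hw

lemma prod_eq_prod_univ (T : Finset K) (u : K → K) :
    ∏ b ∈ T, (1 - C (u b) * X) =
      ∏ w : K, (1 - C w * X) ^ (T.filter fun b => u b = w).card := by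
  rw [← Finset.prod_fiberwise_of_maps_to' (t := Finset.univ) (g := u) (by simp)
    (fun w => (1 - C w * X))]
  simp

lemma prod_filter_pow_eq_one {N : ℕ} (hN : 0 < N)
    (hcard : (Finset.univ.filter fun w : K => w ^ N = 1).card = N) :
    ∏ w ∈ Finset.univ.filter (fun w : K => w ^ N = 1), (1 - C w * X) = 1 - X ^ N := by
  set R := Finset.univ.filter fun w : K => w ^ N = 1 with hR
  have h0 : (0 : K) ∉ R := by simp [hR, hN.ne']
  refine eq_of_degree_sub_lt_of_eval_finset_eq (insert 0 R) ?_ ?_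
  · rw [Finset.card_insert_of_notMem h0, hcard]
    refine lt_of_le_of_lt (degree_le_of_natDegree_le (n := N) ?_) (by exact_mod_cast Nat.lt_succ_self N)
    refine (natDegree_sub_le _ _).trans (max_le ((natDegree_prod_one_sub_le R id).trans hcard.le) ?_)
    exact (natDegree_sub_le _ _).trans (max_le (by simp) (natDegree_X_pow_le _))
  · intro x hx
    rcases Finset.mem_insert.1 hx with rfl | hx
    · simp [eval_prod, hN.ne']
    · have hx1 : x ^ N = 1 := by simpa [hR] using hx
      have hx0 : x ≠ 0 := fun h => h0 (h ▸ hx)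
      rw [eval_sub, eval_one, eval_pow, eval_X, hx1, sub_self, eval_prod]
      refine Finset.prod_eq_zero (i := x⁻¹) (by simp [hR, hx1]) ?_
      simp [hx0]

end FieldLemmas

section AffineArc

variable {K : Type*} [Field K] [Fintype K] [DecidableEq K] {n q : ℕ} {S : Finset K}

/-- A maximal arc in the affine plane of order `q`, modelled on the field `K` of order `q ^ 2`: the
lines through `z` are the sets `{y | (y - z) ^ q = w * (y - z)}` with `w ^ (q + 1) = 1`. -/
structure IsAffineMaximalArc (n q : ℕ) (S : Finset K) : Prop where
  card_field : Fintype.card K = q ^ 2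
  isPrimePow : ∃ p h : ℕ, p.Prime ∧ 0 < h ∧ CharP K p ∧ q = p ^ h
  one_lt : 1 < n
  lt : n < q
  card_eq : S.card = (n - 1) * (q + 1) + 1
  card_le : ∀ z w : K, (S.filter fun b => (b - z) ^ q = w * (b - z)).card ≤ n

namespace IsAffineMaximalArc

lemma sub_pow_eq (hS : IsAffineMaximalArc n q S) (x y : K) : (x - y) ^ q = x ^ q - y ^ q := by
  obtain ⟨p, h, hp, -, hchar, rfl⟩ := hS.isPrimePow
  have := Fact.mk hp
  exact sub_pow_char_pow x y h

lemma one_lt_order (hS : IsAffineMaximalArc n q S) : 1 < q := hS.one_lt.trans hS.lt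

lemma natCast_order (hS : IsAffineMaximalArc n q S) : (q : K) = 0 := by
  obtain ⟨p, h, hp, hh, hchar, rfl⟩ := hS.isPrimePow
  simp [hh.ne']

lemma pow_pow_eq_one (hS : IsAffineMaximalArc n q S) {y : K} (hy : y ≠ 0) :
    (y ^ (q - 1)) ^ (q + 1) = 1 := by
  rw [← pow_mul, mul_comm, ← Nat.sq_sub_sq q 1, one_pow, ← hS.card_field]
  exact FiniteField.pow_card_sub_one_eq_one y hy

lemma pow_eq_mul_iff (hS : IsAffineMaximalArc n q S) {y w : K} (hy : y ≠ 0) :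
    y ^ q = w * y ↔ y ^ (q - 1) = w := by
  have : y ^ q = y ^ (q - 1) * y := by
    rw [← pow_succ, Nat.sub_add_cancel hS.one_lt_order.le]
  rw [this, mul_left_inj' hy]

/-- Both the lines through a point of the arc and the directions are counted here: each line through
`b₀` has `n - 1` further points, and there are `q + 1` directions. -/
lemma card_erase_filter (hS : IsAffineMaximalArc n q S) {b₀ : K} (hb₀ : b₀ ∈ S) :
    (∀ w : K, w ^ (q + 1) = 1 →
      ((S.erase b₀).filter fun b => (b - b₀) ^ (q - 1) = w).card = n - 1) ∧
    (Finset.univ.filter fun w : K => w ^ (q + 1) = 1).card = q + 1 := by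
  have hn := hS.one_lt
  set R := Finset.univ.filter fun w : K => w ^ (q + 1) = 1 with hR
  have hRle : R.card ≤ q + 1 := card_filter_pow_eq_one_le _ (by omega)
  have hle : ∀ w ∈ R, ((S.erase b₀).filter fun b => (b - b₀) ^ (q - 1) = w).card ≤ n - 1 := by
    intro w _
    have h1 := hS.card_le b₀ w
    have h2 : insert b₀ ((S.erase b₀).filter fun b => (b - b₀) ^ (q - 1) = w) ⊆
        S.filter fun b => (b - b₀) ^ q = w * (b - b₀) := by
      intro b hb
      rw [Finset.mem_insert, Finset.mem_filter, Finset.mem_erase] at hb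
      rw [Finset.mem_filter]
      rcases hb with rfl | ⟨⟨hne, hbS⟩, hb⟩
      · refine ⟨hb₀, ?_⟩
        rw [sub_self, mul_zero, zero_pow (by have := hS.one_lt_order; omega)]
      · exact ⟨hbS, (hS.pow_eq_mul_iff (sub_ne_zero.2 hne)).2 hb⟩
    have h3 := Finset.card_le_card h2
    rw [Finset.card_insert_of_notMem (by simp)] at h3
    omega
  have hsum : (n - 1) * (q + 1) =
      ∑ w ∈ R, ((S.erase b₀).filter fun b => (b - b₀) ^ (q - 1) = w).card := by
    rw [← Finset.card_eq_sum_card_fiberwise, Finset.card_erase_of_mem hb₀, hS.card_eq,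
      Nat.add_sub_cancel]
    intro b hb
    simp only [Finset.coe_erase, Set.mem_sdiff, Set.mem_singleton_iff] at hb
    simp only [hR, Finset.coe_filter, Finset.mem_univ, true_and, Set.mem_ofPred_eq]
    exact hS.pow_pow_eq_one (sub_ne_zero.2 hb.2)
  have hRcard : R.card = q + 1 := by
    refine le_antisymm hRle ?_
    have h1 := Finset.sum_le_card_nsmul R _ _ hle
    rw [← hsum, smul_eq_mul, mul_comm] at h1
    exact Nat.le_of_mul_le_mul_right h1 (by omega)
  refine ⟨fun w hw => ?_, hRcard⟩
  have h1 := (Finset.sum_eq_sum_iff_of_le hle).1 (by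
    rw [← hsum, Finset.sum_const, hRcard, smul_eq_mul, mul_comm])
  exact h1 w (by simp [hR, hw])

lemma card_line_eq (hS : IsAffineMaximalArc n q S) {b₀ : K} (hb₀ : b₀ ∈ S) {w : K}
    (hw : w ^ (q + 1) = 1) : (S.filter fun b => (b - b₀) ^ q = w * (b - b₀)).card = n := by
  have h : (S.filter fun b => (b - b₀) ^ q = w * (b - b₀)) =
      insert b₀ ((S.erase b₀).filter fun b => (b - b₀) ^ (q - 1) = w) := by
    ext b
    rw [Finset.mem_insert, Finset.mem_filter, Finset.mem_filter, Finset.mem_erase]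
    by_cases hb : b = b₀
    · subst hb
      have : q ≠ 0 := by have := hS.one_lt_order; omega
      simp [hb₀, this]
    · simp [hb, hS.pow_eq_mul_iff (sub_ne_zero.2 hb)]
  rw [h, Finset.card_insert_of_notMem (by simp), (hS.card_erase_filter hb₀).1 w hw]
  have := hS.one_lt
  omega

/-- Every line through a point off the arc meets the arc in `0` or `n` points. -/
lemma dvd_card_filter (hS : IsAffineMaximalArc n q S) {z : K} (hz : z ∉ S) (w : K) :
    n ∣ (S.filter fun b => (b - z) ^ (q - 1) = w).card := by
  rcases (S.filter fun b => (b - z) ^ (q - 1) = w).eq_empty_or_nonempty with h | ⟨b₁, hb₁⟩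
  · simp [h]
  rw [Finset.mem_filter] at hb₁
  obtain ⟨hb₁, h₁⟩ := hb₁
  have hne : ∀ b ∈ S, b - z ≠ 0 := fun b hb h0 => hz (sub_eq_zero.1 h0 ▸ hb)
  have hw : w ^ (q + 1) = 1 := h₁ ▸ hS.pow_pow_eq_one (hne b₁ hb₁)
  rw [← hS.card_line_eq hb₁ hw]
  refine dvd_of_eq (congrArg _ (Finset.filter_congr fun b hb => ?_))
  rw [← hS.pow_eq_mul_iff (hne b₁ hb₁)] at h₁
  rw [← hS.pow_eq_mul_iff (hne b hb)]
  rw [hS.sub_pow_eq] at h₁ ⊢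
  rw [hS.sub_pow_eq]
  constructor <;> intro h
  · linear_combination h + h₁
  · linear_combination h - h₁

lemma dvd_order (hS : IsAffineMaximalArc n q S) (h0 : (0 : K) ∉ S) : n ∣ q := by
  have h1 : n ∣ S.card := by
    rw [Finset.card_eq_sum_card_fiberwise (f := fun b => (b - 0) ^ (q - 1)) (t := Finset.univ)
      (by simp)]
    exact Finset.dvd_sum fun w _ => hS.dvd_card_filter h0 w
  rw [hS.card_eq] at h1
  obtain ⟨m, rfl⟩ : ∃ m, n = m + 1 := ⟨n - 1, by have := hS.one_lt; omega⟩
  rw [Nat.add_sub_cancel, mul_add, mul_one, add_assoc] at h1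
  have h2 : m + 1 ∣ m * q := (Nat.dvd_add_left (dvd_refl _)).1 h1
  exact (Nat.Coprime.dvd_mul_left (by simp)).1 h2

/-- Away from the inverses of the points of the arc, the direction polynomial is an `n`-th power. -/
lemma coeff_eq_zero_of_not_dvd (hS : IsAffineMaximalArc n q S) (h0 : (0 : K) ∉ S) {x : K}
    (hx : ∀ b ∈ S, 1 - b * x ≠ 0) {i : ℕ} (hi : ¬ n ∣ i) :
    (∏ b ∈ S, (1 - C ((1 - b * x) ^ (q - 1)) * X)).coeff i = 0 := by
  have hnq := hS.dvd_order h0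
  obtain ⟨p, h, hp, hh, hchar, hq⟩ := hS.isPrimePow
  have := Fact.mk hp
  obtain ⟨k, -, hk⟩ := (Nat.dvd_prime_pow hp).1 (hq ▸ hnq)
  have hdvd : ∀ w : K, n ∣ (S.filter fun b => (1 - b * x) ^ (q - 1) = w).card := by
    intro w
    by_cases hx0 : x = 0
    · subst hx0
      simp only [mul_zero, sub_zero, one_pow, Finset.filter_const]
      split_ifs
      · rw [hS.card_eq]
        obtain ⟨m, rfl⟩ : ∃ m, n = m + 1 := ⟨n - 1, by have := hS.one_lt; omega⟩
        rw [Nat.add_sub_cancel, mul_add, mul_one, add_assoc]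
        exact dvd_add (hnq.mul_left _) (dvd_refl _)
      · simp
    · simp only [one_sub_mul_pow_eq_iff hx0]
      refine hS.dvd_card_filter (fun hmem => hx _ hmem ?_) _
      rw [inv_mul_cancel₀ hx0, sub_self]
  choose c hc using hdvd
  rw [prod_eq_prod_univ]
  simp only [hc, mul_comm n, pow_mul]
  rw [Finset.prod_pow]
  subst hk
  exact coeff_pow_prime_pow_eq_zero p k _ hi

/-- At the inverse of a point of the arc, the direction polynomial is `(1 - t ^ (q + 1)) ^ (n - 1)`. -/
lemma coeff_eq_zero_of_mem (hS : IsAffineMaximalArc n q S) {b₀ : K} (hb₀ : b₀ ∈ S) (h0 : b₀ ≠ 0)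
    {i : ℕ} (hi0 : 0 < i) (hi : i < q) :
    (∏ b ∈ S, (1 - C ((1 - b * b₀⁻¹) ^ (q - 1)) * X)).coeff i = 0 := by
  have hq := hS.one_lt_order
  have hcard := hS.card_erase_filter hb₀
  rw [← Finset.mul_prod_erase _ _ hb₀, mul_inv_cancel₀ h0, sub_self, zero_pow (by omega), C_0,
    zero_mul, sub_zero, one_mul, prod_eq_prod_univ,
    ← Finset.prod_subset (Finset.subset_univ (Finset.univ.filter fun w : K => w ^ (q + 1) = 1))]
  · rw [Finset.prod_congr rfl (g := fun w => (1 - C w * X) ^ (n - 1)), Finset.prod_pow,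
      prod_filter_pow_eq_one (by omega) hcard.2]
    · have : (1 - X ^ (q + 1) : K[X]) ^ (n - 1) = expand K (q + 1) ((1 - X) ^ (n - 1)) := by simp
      rw [this, coeff_expand (by omega), if_neg (Nat.not_dvd_of_pos_of_lt hi0 (by omega))]
    · intro w hw
      rw [Finset.mem_filter] at hw
      congr 1
      simp only [one_sub_mul_pow_eq_iff (inv_ne_zero h0), inv_inv]
      refine hcard.1 _ ?_
      rw [div_pow, hw.2, hS.pow_pow_eq_one (neg_ne_zero.2 (inv_ne_zero h0)), div_one]
  · intro w _ hw
    rw [Finset.card_eq_zero.2, pow_zero]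
    refine Finset.filter_eq_empty_iff.2 fun b hb hbw => hw ?_
    rw [Finset.mem_filter, ← hbw]
    refine ⟨Finset.mem_univ _, hS.pow_pow_eq_one ?_⟩
    rw [Finset.mem_erase] at hb
    intro h
    exact hb.1 (eq_of_div_eq_one ((div_eq_mul_inv b b₀).trans (sub_eq_zero.1 h).symm))

lemma coeff_directionPoly_eq_zero (hS : IsAffineMaximalArc n q S) (h0 : (0 : K) ∉ S) {i : ℕ}
    (hiq : i < q) (hi : ¬ n ∣ i) : (directionPoly q S).coeff i = 0 := by
  have hi0 : 0 < i := Nat.pos_of_ne_zero fun h => hi (h ▸ dvd_zero n)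
  refine eq_zero_of_natDegree_lt_card_of_eval_eq_zero _ Function.injective_id (fun x => ?_) ?_
  · rw [id, eval_coeff_directionPoly]
    by_cases hx : ∀ b ∈ S, 1 - b * x ≠ 0
    · exact hS.coeff_eq_zero_of_not_dvd h0 hx hi
    · push Not at hx
      obtain ⟨b, hb, hbx⟩ := hx
      rw [eq_inv_of_one_sub_mul_eq_zero hbx]
      exact hS.coeff_eq_zero_of_mem hb (fun h => h0 (h ▸ hb)) hi0 hiq
  · rw [hS.card_field]
    calc _ ≤ i * (q - 1) := natDegree_coeff_directionPoly_le q S i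
      _ ≤ q * (q - 1) := Nat.mul_le_mul_right _ hiq.le
      _ < q ^ 2 := by rw [sq]; exact Nat.mul_lt_mul_of_pos_left (by omega) (by omega)

lemma eval_derivative_pointPoly_mul (hS : IsAffineMaximalArc n q S) (h0 : (0 : K) ∉ S) (x : K) :
    (derivative (pointPoly S * (directionPoly q S).coeff n)).eval x = 0 := by
  have hq := hS.one_lt_order
  have hn := hS.one_lt
  rw [derivative_mul, eval_add, eval_mul, eval_mul]
  by_cases hx : ∀ b ∈ S, 1 - b * x ≠ 0
  · have hrel := one_sub_X_pow_mul_map_coeffDerivative hq hS.natCast_order S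
      (fun b hb => hS.pow_pow_eq_one (hx b hb))
    have hnq := hS.dvd_order h0
    set F := (directionPoly q S).map (evalRingHom x) with hF
    set G := (coeffDerivative (directionPoly q S)).map (evalRingHom x) with hG
    set P := ∑ b ∈ S, C (b / (1 - b * x)) *
      ∑ i ∈ Finset.range q, (C ((1 - b * x) ^ (q - 1)) * X) ^ (i + 1) with hP
    set c := ∑ b ∈ S, b / (1 - b * x) with hc
    have hPc : ∑ b ∈ S, C (b / (1 - b * x)) *
        ∑ i ∈ Finset.range (q + 1), (C ((1 - b * x) ^ (q - 1)) * X) ^ (i + 1) =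
          P + C c * X ^ (q + 1) := by
      rw [hP, hc, map_sum, Finset.sum_mul, ← Finset.sum_add_distrib]
      refine Finset.sum_congr rfl fun b hb => ?_
      rw [Finset.sum_range_succ, mul_add, mul_pow _ X, ← C_pow, hS.pow_pow_eq_one (hx b hb), C_1,
        one_mul]
    rw [hPc] at hrel
    have hFn : ∀ i, ¬ n ∣ i → F.coeff i = 0 := fun i hi => by
      rw [hF, map_directionPoly]
      exact hS.coeff_eq_zero_of_not_dvd h0 hx hi
    have hF0 : F.coeff 0 = 1 := by
      rw [hF, coeff_map, coeff_zero_directionPoly, map_one]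
    have hGi : ∀ i, G.coeff i = (derivative ((directionPoly q S).coeff i)).eval x := fun i => by
      rw [hG, coeff_map, coeff_coeffDerivative, coe_evalRingHom]
    have hPdeg : P.natDegree ≤ q := by
      refine natDegree_sum_le_of_forall_le _ _ fun b _ => (natDegree_C_mul_le _ _).trans ?_
      refine natDegree_sum_le_of_forall_le _ _ fun i hi => ?_
      rw [mul_pow, ← C_pow]
      refine (natDegree_C_mul_X_pow_le _ _).trans ?_
      have := Finset.mem_range.1 hi
      omega
    have hPn : ∀ i, ¬ n ∣ i → P.coeff i = 0 := by
      intro i hi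
      rcases le_or_gt i q with hiq | hiq
      · refine coeff_eq_zero_of_coeff_mul_eq_zero hF0 hFn (m := q) (fun j hj hjn => ?_) i hiq hi
        have hjq : j < q := lt_of_le_of_ne hj fun h => hjn (h ▸ hnq)
        have h1 := congrArg (fun f => coeff f j) hrel
        simp only [sub_mul, one_mul, mul_add, coeff_sub, coeff_neg, coeff_add] at h1
        rw [coeff_X_pow_mul', if_neg (by omega), ← mul_assoc, coeff_mul_X_pow', if_neg (by omega),
          hGi, hS.coeff_directionPoly_eq_zero h0 hjq hjn] at h1
        simpa using h1
      · exact coeff_eq_zero_of_natDegree_lt (by omega)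
    have hGdeg : G.natDegree ≤ (n - 1) * (q + 1) + 1 := by
      rw [← hS.card_eq]
      exact natDegree_map_le.trans ((natDegree_coeffDerivative_le _).trans
        (natDegree_prod_one_sub_le _ _))
    have key := coeff_eq_of_one_sub_X_pow_mul hn (by simpa using hnq) (by omega) hFn hPn hGdeg hrel
    rw [hGi, hF, coeff_map, coe_evalRingHom] at key
    rw [key, eval_derivative_pointPoly S hx]
    ring
  · push Not at hx
    obtain ⟨b, hb, hbx⟩ := hx
    have h1 : (pointPoly S).eval x = 0 := by
      rw [pointPoly, eval_prod]
      exact Finset.prod_eq_zero hb (by simpa using hbx)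
    have h2 : ((directionPoly q S).coeff n).eval x = 0 := by
      rw [eval_coeff_directionPoly, eq_inv_of_one_sub_mul_eq_zero hbx]
      exact hS.coeff_eq_zero_of_mem hb (fun h => h0 (h ▸ hb)) (by omega) hS.lt
    rw [h1, h2]
    ring

lemma coeff_directionPoly_ne_zero (hS : IsAffineMaximalArc n q S) (h0 : (0 : K) ∉ S) :
    (directionPoly q S).coeff n ≠ 0 := by
  have hnq := hS.dvd_order h0
  have hn := hS.one_lt
  have hlt := hS.lt
  obtain ⟨p, h, hp, hh, hchar, hq⟩ := hS.isPrimePow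
  have := Fact.mk hp
  obtain ⟨k, hkh, hk⟩ := (Nat.dvd_prime_pow hp).1 (hq ▸ hnq)
  intro hzero
  have h1 := eval_coeff_directionPoly q S 0 n
  have hkh' : k < h := lt_of_le_of_ne hkh (by rintro rfl; omega)
  have hcard : S.card = ((n - 1) * p ^ (h - k) + 1) * n := by
    rw [hS.card_eq, hq, ← Nat.sub_add_cancel hkh, pow_add, ← hk, Nat.sub_add_cancel hkh]
    obtain ⟨m, rfl⟩ : ∃ m, n = m + 1 := ⟨n - 1, by omega⟩
    rw [Nat.add_sub_cancel]
    ring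
  set m := (n - 1) * p ^ (h - k) + 1 with hm
  have hmK : (m : K) = 1 := by
    have : h - k ≠ 0 := by omega
    simp [hm, this]
  have hexp : (1 - X : K[X]) ^ (m * n) = expand K n ((1 - X) ^ m) := by
    rw [mul_comm, pow_mul]
    conv_lhs => rw [hk]
    rw [sub_pow_char_pow, one_pow, ← hk]
    simp
  have hc1 : ((1 - X : K[X]) ^ m).coeff 1 = -1 := by
    have h2 := coeff_derivative ((1 - X : K[X]) ^ m) 0
    rw [derivative_pow, coeff_zero_eq_eval_zero] at h2
    simp [hmK] at h2
    exact h2.symm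
  simp only [hzero, eval_zero, mul_zero, sub_zero, one_pow, C_1, one_mul, Finset.prod_const, hcard,
    hexp, coeff_expand (show 0 < n by omega), dvd_refl, if_true, Nat.div_self (show 0 < n by omega),
    hc1] at h1
  exact one_ne_zero (neg_eq_zero.1 h1.symm)

lemma three_mul_le (hS : IsAffineMaximalArc n q S) (h0 : (0 : K) ∉ S) (hodd : Odd q) :
    3 * n ≤ q := by
  obtain ⟨m, rfl⟩ := hS.dvd_order h0
  have hm : Odd m := (Nat.odd_mul.1 hodd).2
  have hlt := hS.lt
  have : m ≠ 1 := by rintro rfl; omega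
  have h3 : 3 ≤ m := by
    obtain ⟨r, rfl⟩ := hm
    omega
  rw [mul_comm]
  exact Nat.mul_le_mul_left n h3

theorem zero_mem_of_odd (hS : IsAffineMaximalArc n q S) (hodd : Odd q) : (0 : K) ∈ S := by
  by_contra h0
  have hn := hS.one_lt
  have hlt := hS.lt
  have h3 := hS.three_mul_le h0 hodd
  set B := pointPoly S with hB
  set f := (directionPoly q S).coeff n with hf
  have hf0 : f ≠ 0 := hS.coeff_directionPoly_ne_zero h0
  have hBdeg : B.natDegree = (n - 1) * (q + 1) + 1 := by
    rw [hB, natDegree_pointPoly h0, hS.card_eq]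
  have hfdeg : f.natDegree ≤ n * (q - 1) := natDegree_coeff_directionPoly_le q S n
  obtain ⟨m, rfl⟩ : ∃ m, n = m + 1 := ⟨n - 1, by omega⟩
  obtain ⟨r, rfl⟩ : ∃ r, q = r + 1 := ⟨q - 1, by omega⟩
  rw [Nat.add_sub_cancel] at hBdeg hfdeg
  have hder : derivative (B * f) = 0 := by
    refine eq_zero_of_natDegree_lt_card_of_eval_eq_zero _ Function.injective_id
      (fun x => hS.eval_derivative_pointPoly_mul h0 x) ?_
    rw [hS.card_field]
    have h4 := natDegree_derivative_le (B * f)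
    have h5 := natDegree_mul_le (p := B) (q := f)
    have h6 := Nat.mul_le_mul_right r (show 3 * m + 2 ≤ r by omega)
    have h7 := h4.trans (Nat.sub_le _ _ |>.trans (h5.trans (add_le_add hBdeg.le hfdeg)))
    have h8 := Nat.zero_le (m * r)
    nlinarith
  have hBf : B ∣ f := by
    refine Finset.prod_dvd_of_coprime (fun b _ c _ hbc => isCoprime_one_sub hbc) fun b hb => ?_
    have hb0 : b ≠ 0 := fun h => h0 (h ▸ hb)
    have hroot : X - C b⁻¹ ∣ f := by
      rw [dvd_iff_isRoot, IsRoot, hf, eval_coeff_directionPoly]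
      exact hS.coeff_eq_zero_of_mem hb hb0 (by omega) hlt
    refine dvd_trans ⟨C (-b)⁻¹, ?_⟩ hroot
    have : (C b * C b⁻¹ : K[X]) = 1 := by rw [← C_mul, mul_inv_cancel₀ hb0, C_1]
    rw [inv_neg, C_neg]
    linear_combination -X * this
  obtain ⟨g, hg⟩ := hBf
  have hB0 : B ≠ 0 := by
    intro h
    rw [h, natDegree_zero] at hBdeg
    omega
  have hrel : 2 * derivative B * g + B * derivative g = 0 := by
    rw [hg, derivative_mul, derivative_mul] at hder
    apply mul_left_cancel₀ hB0
    linear_combination hder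
  have h2 : (2 : K) ≠ 0 := by
    obtain ⟨p, h, hp, hh, hchar, hq⟩ := hS.isPrimePow
    have hpodd : Odd p := (Nat.odd_pow_iff hh.ne').1 (hq ▸ hodd)
    exact Ring.two_ne_zero (by
      rw [ringChar.eq K p]
      rintro rfl
      exact absurd hpodd (by decide))
  have hBg : B ∣ g := by
    refine (separable_def _ |>.1 (separable_pointPoly S)).dvd_of_dvd_mul_left
      ⟨-C (2⁻¹) * derivative g, ?_⟩
    have : (C 2⁻¹ * 2 : K[X]) = 1 := by
      rw [show (2 : K[X]) = C 2 from rfl, ← C_mul, inv_mul_cancel₀ h2, C_1]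
    linear_combination C 2⁻¹ * hrel - derivative B * g * this
  obtain ⟨k, rfl⟩ := hBg
  have hk0 : k ≠ 0 := by
    rintro rfl
    exact hf0 (by rw [hg]; simp)
  rw [hg, natDegree_mul hB0 (mul_ne_zero hB0 hk0), natDegree_mul hB0 hk0, hBdeg] at hfdeg
  nlinarith

lemma image_sub (hS : IsAffineMaximalArc n q S) (c : K) :
    IsAffineMaximalArc n q (S.image fun b => b - c) where
  card_field := hS.card_field
  isPrimePow := hS.isPrimePow
  one_lt := hS.one_lt
  lt := hS.lt
  card_eq := by rw [Finset.card_image_of_injective _ sub_left_injective, hS.card_eq]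
  card_le z w := by
    rw [Finset.filter_image]
    refine Finset.card_image_le.trans ?_
    simpa only [sub_sub, add_comm c] using hS.card_le (z + c) w

theorem not_odd (hS : IsAffineMaximalArc n q S) : ¬ Odd q := by
  intro hodd
  have hlt : S.card < Fintype.card K := by
    have hn := hS.one_lt
    have hnq := hS.lt
    rw [hS.card_field, hS.card_eq]
    obtain ⟨m, rfl⟩ : ∃ m, n = m + 1 := ⟨n - 1, by omega⟩
    have := Nat.mul_le_mul_right (q + 1) (show m + 2 ≤ q by omega)
    rw [Nat.add_sub_cancel]
    nlinarith
  obtain ⟨c, -, hc⟩ := Finset.exists_mem_notMem_of_card_lt_card (t := Finset.univ) hlt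
  obtain ⟨b, hb, hbc⟩ := Finset.mem_image.1 ((hS.image_sub c).zero_mem_of_odd hodd)
  exact hc (sub_eq_zero.1 hbc ▸ hb)

end IsAffineMaximalArc

end AffineArc

section ProjectivePlane

variable {F V : Type*} [Field F] [AddCommGroup V] [Module F V]

lemma card_finrank_eq_one : Nat.card {P : Submodule F V // finrank F P = 1} =
    Nat.card (Projectivization F V) := (Nat.card_congr (Projectivization.equivSubmodule F V)).symm

lemma finrank_map_mkQ [FiniteDimensional F V] {Q L : Submodule F V} (hQL : Q ≤ L) :
    finrank F (L.map Q.mkQ) + finrank F Q = finrank F L := by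
  have h1 := (Submodule.quotientQuotientEquivQuotient Q L hQL).finrank_eq
  have h2 := Submodule.finrank_quotient_add_finrank L
  have h3 := Submodule.finrank_quotient_add_finrank Q
  have h4 := Submodule.finrank_quotient_add_finrank (L.map Q.mkQ)
  omega

lemma finrank_sup_eq_two [FiniteDimensional F V] {P Q : Submodule F V} (hP : finrank F P = 1)
    (hQ : finrank F Q = 1) (hPQ : P ≠ Q) : finrank F (P ⊔ Q : Submodule F V) = 2 := by
  have h1 := Submodule.finrank_sup_add_finrank_inf_eq P Q
  have h2 : finrank F (P ⊓ Q : Submodule F V) ≠ 1 := fun h => hPQ <|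
    (Submodule.eq_of_le_of_finrank_eq inf_le_left (h.trans hP.symm)).symm.trans
      (Submodule.eq_of_le_of_finrank_eq inf_le_right (h.trans hQ.symm))
  have h3 := Submodule.finrank_mono (inf_le_left : P ⊓ Q ≤ P)
  omega

lemma sup_eq_iff [FiniteDimensional F V] {P Q L : Submodule F V} (hP : finrank F P = 1)
    (hQ : finrank F Q = 1) (hPQ : P ≠ Q) (hL : finrank F L = 2) (hQL : Q ≤ L) :
    P ⊔ Q = L ↔ P ≤ L :=
  ⟨fun h => h ▸ le_sup_left, fun h => Submodule.eq_of_le_of_finrank_eq (sup_le h hQL)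
    ((finrank_sup_eq_two hP hQ hPQ).trans hL.symm)⟩

variable {K : Type*} [Field K] [Algebra F K]

/-- Coordinates in which a given line of the projective plane is the line at infinity. -/
lemma exists_linearEquiv_prod (hV : finrank F V = 3) (hK : finrank F K = 2) {L : Submodule F V}
    (hL : finrank F L = 2) : ∃ e : V ≃ₗ[F] F × K, ∀ v, (e v).1 = 0 → v ∈ L := by
  have : FiniteDimensional F V := .of_finrank_pos (by omega)
  have : FiniteDimensional F K := .of_finrank_pos (by omega)
  obtain ⟨Q, hQ⟩ := L.exists_isCompl
  have h1 := Submodule.finrank_add_eq_of_isCompl hQ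
  let e₁ : Q ≃ₗ[F] F := LinearEquiv.ofFinrankEq _ _ (by rw [finrank_self]; omega)
  let e₂ : L ≃ₗ[F] K := LinearEquiv.ofFinrankEq _ _ (by omega)
  let e := (e₁.prodCongr e₂).symm.trans (Submodule.prodEquivOfIsCompl Q L hQ.symm)
  refine ⟨e.symm, fun v hv => ?_⟩
  have h2 : v = e (e.symm v) := (e.apply_symm_apply v).symm
  have h3 : e.symm v = (0, (e.symm v).2) := Prod.ext hv rfl
  rw [h2, h3]
  simp [e]

variable [Fintype F]

/-- A point of a projective plane of order `q` lies on `q + 1` lines. -/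
lemma card_lines_through (hV : finrank F V = 3) {Q : Submodule F V} (hQ : finrank F Q = 1) :
    Nat.card {L : Submodule F V // Q ≤ L ∧ finrank F L = 2} = Fintype.card F + 1 := by
  have : FiniteDimensional F V := .of_finrank_pos (by omega)
  have e : {L : Submodule F V // Q ≤ L ∧ finrank F L = 2} ≃
      {H : Submodule F (V ⧸ Q) // finrank F H = 1} :=
    (Equiv.subtypeSubtypeEquivSubtypeInter (fun L => Q ≤ L) (fun L => finrank F L = 2)).symm.trans
      (Equiv.subtypeEquiv (Submodule.comapMkQRelIso Q).symm.toEquiv fun L => by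
        have h := finrank_map_mkQ L.2
        change finrank F L.1 = 2 ↔ finrank F (L.1.map Q.mkQ) = 1
        omega)
  have h2 : finrank F (V ⧸ Q) = 2 := by
    have := Submodule.finrank_quotient_add_finrank Q
    omega
  rw [Nat.card_congr e, card_finrank_eq_one, Projectivization.card_of_finrank_two F _ h2,
    Nat.card_eq_fintype_card]

/-- A maximal arc has an external line. -/
lemma exists_external_line [Finite V] [DecidableEq (Submodule F V)] (hV : finrank F V = 3) {n : ℕ}
    (hn : 1 < n) (hnq : n < Fintype.card F) (B : Finset (Submodule F V))
    (hB : ∀ P ∈ B, finrank F P = 1)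
    (hline : ∀ L : Submodule F V, finrank F L = 2 → Set.ncard {P | P ∈ B ∧ P ≤ L} ≤ n)
    (hcard : B.card = (n - 1) * (Fintype.card F + 1) + 1) :
    ∃ L : Submodule F V, finrank F L = 2 ∧ ∀ P ∈ B, ¬ P ≤ L := by
  classical
  set q := Fintype.card F with hq
  have : FiniteDimensional F V := .of_finrank_pos (by omega)
  have : Fintype (Submodule F V) := Fintype.ofFinite _
  have hline' : ∀ L : Submodule F V, finrank F L = 2 → (B.filter fun P => P ≤ L).card ≤ n := by
    intro L hL
    rw [← Set.ncard_coe_finset]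
    simpa using hline L hL
  let T : Submodule F V → Finset (Submodule F V) := fun Q =>
    Finset.univ.filter fun L => Q ≤ L ∧ finrank F L = 2
  have hT : ∀ Q : Submodule F V, finrank F Q = 1 → (T Q).card = q + 1 := by
    intro Q hQ
    rw [hq, ← card_lines_through hV hQ, Nat.card_eq_fintype_card, Fintype.card_subtype]
  have hmemT : ∀ {Q L : Submodule F V}, L ∈ T Q ↔ Q ≤ L ∧ finrank F L = 2 := by simp [T]
  have hsum : ∀ Q : Submodule F V, finrank F Q = 1 →
      (B.erase Q).card = ∑ L ∈ T Q, ((B.erase Q).filter fun P => P ≤ L).card := by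
    intro Q hQ
    rw [Finset.card_eq_sum_card_fiberwise (f := fun P => P ⊔ Q) (t := T Q)]
    · refine Finset.sum_congr rfl fun L hL => congrArg _ (Finset.filter_congr fun P hP => ?_)
      rw [Finset.mem_erase] at hP
      exact sup_eq_iff (hB P hP.2) hQ hP.1 (hmemT.1 hL).2 (hmemT.1 hL).1
    · intro P hP
      rw [Finset.mem_coe, Finset.mem_erase] at hP
      exact hmemT.2 ⟨le_sup_right, finrank_sup_eq_two (hB P hP.2) hQ hP.1⟩
  have hsecant : ∀ Q ∈ B, ∀ L : Submodule F V, finrank F L = 2 → Q ≤ L →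
      (B.filter fun P => P ≤ L).card = n := by
    intro Q hQ L hL hQL
    have herase : ∀ L ∈ T Q, ((B.erase Q).filter fun P => P ≤ L).card + 1 =
        (B.filter fun P => P ≤ L).card := by
      intro L hL
      rw [Finset.filter_erase, Finset.card_erase_add_one]
      exact Finset.mem_filter.2 ⟨hQ, (hmemT.1 hL).1⟩
    have hle : ∀ L ∈ T Q, ((B.erase Q).filter fun P => P ≤ L).card ≤ n - 1 := fun L hL => by
      have h1 := herase L hL
      have h2 := hline' L (hmemT.1 hL).2
      omega
    have h1 := (Finset.sum_eq_sum_iff_of_le hle).1 (by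
      rw [← hsum Q (hB Q hQ), Finset.card_erase_of_mem hQ, hcard, Finset.sum_const,
        hT Q (hB Q hQ), smul_eq_mul, mul_comm, Nat.add_sub_cancel]) L (hmemT.2 ⟨hQL, hL⟩)
    have h2 := herase L (hmemT.2 ⟨hQL, hL⟩)
    omega
  obtain ⟨Q, hQ, hQB⟩ : ∃ Q : Submodule F V, finrank F Q = 1 ∧ Q ∉ B := by
    by_contra! hall
    have h1 : Nat.card {P : Submodule F V // finrank F P = 1} ≤ B.card := by
      rw [Nat.card_eq_fintype_card, Fintype.card_subtype]
      exact Finset.card_le_card fun P hP => hall P (Finset.mem_filter.1 hP).2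
    rw [card_finrank_eq_one, Projectivization.card_of_finrank F V hV, hcard,
      Nat.card_eq_fintype_card] at h1
    simp only [Finset.sum_range_succ, Finset.sum_range_zero] at h1
    obtain ⟨m, rfl⟩ : ∃ m, n = m + 1 := ⟨n - 1, by omega⟩
    have := Nat.mul_le_mul_right (q + 1) (show m + 2 ≤ q by omega)
    rw [Nat.add_sub_cancel] at h1
    nlinarith
  by_contra! hall
  have h1 := hsum Q hQ
  rw [Finset.erase_eq_of_notMem hQB, hcard, Finset.sum_congr rfl (g := fun _ => n)] at h1
  · rw [Finset.sum_const, hT Q hQ, smul_eq_mul] at h1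
    obtain ⟨m, rfl⟩ : ∃ m, n = m + 1 := ⟨n - 1, by omega⟩
    rw [Nat.add_sub_cancel] at h1
    nlinarith
  · intro L hL
    obtain ⟨P, hP, hPL⟩ := hall L (hmemT.1 hL).2
    exact hsecant P hP L (hmemT.1 hL).2 hPL

lemma exists_algebraMap_eq_of_pow_card_eq {y : K} (hy : y ^ Fintype.card F = y) :
    ∃ a : F, algebraMap F K a = y := by
  have h1 : (X ^ Fintype.card F - X : F[X]) = ∏ a : F, (X - C a) := by
    have h2 := FiniteField.X_pow_card_sub_X_natDegree_eq F (Fintype.one_lt_card (α := F))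
    have h3 := prod_multiset_X_sub_C_of_monic_of_roots_card_eq
      (p := (X ^ Fintype.card F - X : F[X]))
      (monic_X_pow_sub (by rw [degree_X]; exact_mod_cast Fintype.one_lt_card))
      (by rw [h2, FiniteField.roots_X_pow_card_sub_X]; rfl)
    rw [← h3, FiniteField.roots_X_pow_card_sub_X]
    rfl
  have h3 := congrArg (fun f => aeval y f) h1
  simp only [map_sub, map_pow, aeval_X, hy, sub_self, map_prod, aeval_C] at h3
  obtain ⟨a, -, ha⟩ := Finset.prod_eq_zero_iff.1 h3.symm
  exact ⟨a, (sub_eq_zero.1 ha).symm⟩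

lemma exists_pow_card_eq_mul_imp_mem_span (w : K) :
    ∃ d : K, ∀ y : K, y ^ Fintype.card F = w * y → y ∈ Submodule.span F {d} := by
  by_cases h : ∃ d : K, d ≠ 0 ∧ d ^ Fintype.card F = w * d
  · obtain ⟨d, hd0, hd⟩ := h
    refine ⟨d, fun y hy => ?_⟩
    obtain ⟨a, ha⟩ := exists_algebraMap_eq_of_pow_card_eq (F := F) (y := y / d) (by
      have hw : w ≠ 0 := by
        rintro rfl
        exact hd0 (pow_eq_zero_iff Fintype.card_ne_zero |>.1 (by rw [hd, zero_mul]))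
      rw [div_pow, hy, hd, mul_div_mul_left _ _ hw])
    rw [Submodule.mem_span_singleton]
    exact ⟨a, by rw [Algebra.smul_def, ha, div_mul_cancel₀ _ hd0]⟩
  · push Not at h
    refine ⟨0, fun y hy => ?_⟩
    by_contra hy0
    exact h y (by rintro rfl; exact hy0 (Submodule.zero_mem _)) hy

/-- The affine arc obtained from a maximal arc of the projective plane by removing an external
line. -/
lemma exists_isAffineMaximalArc [Fintype K] [DecidableEq K] {p h n : ℕ} (hp : p.Prime) (hh : 0 < h)
    (hF : Fintype.card F = p ^ h) (hK : finrank F K = 2) (hV : finrank F V = 3) (hn : 1 < n)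
    (hnq : n < Fintype.card F) (B : Finset (Submodule F V)) (hB : ∀ P ∈ B, finrank F P = 1)
    (hline : ∀ L : Submodule F V, finrank F L = 2 → Set.ncard {P | P ∈ B ∧ P ≤ L} ≤ n)
    (hcard : B.card = (n - 1) * (Fintype.card F + 1) + 1) :
    ∃ S : Finset K, IsAffineMaximalArc n (Fintype.card F) S := by
  classical
  have : FiniteDimensional F V := .of_finrank_pos (by omega)
  have : Finite V := Module.finite_of_finite F
  obtain ⟨L, hL, hBL⟩ := exists_external_line hV hn hnq B hB hline hcard
  obtain ⟨e, he⟩ := exists_linearEquiv_prod (K := K) hV hK hL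
  have hrep : ∀ P ∈ B, ∃ v ∈ P, (e v).1 = 1 := by
    intro P hP
    obtain ⟨v, hvP, hvL⟩ := Set.not_subset.1 (hBL P hP)
    have hv : (e v).1 ≠ 0 := fun h0 => hvL (he v h0)
    exact ⟨(e v).1⁻¹ • v, P.smul_mem _ hvP, by simp [hv]⟩
  choose! v hvP hv using hrep
  have hspan : ∀ P ∈ B, P = Submodule.span F {v P} := by
    intro P hP
    refine (Submodule.eq_of_le_of_finrank_eq ?_ ?_).symm
    · rw [Submodule.span_singleton_le_iff_mem]
      exact hvP P hP
    · rw [hB P hP, finrank_span_singleton]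
      intro h0
      have := hv P hP
      simp [h0] at this
  have hinj : Set.InjOn (fun P => (e (v P)).2) (B : Set (Submodule F V)) := by
    intro P hP P' hP' heq
    rw [hspan P hP, hspan P' hP', e.injective (Prod.ext ((hv P hP).trans (hv P' hP').symm) heq)]
  refine ⟨B.image fun P => (e (v P)).2, ?_, ?_, hn, hnq, ?_, fun z w => ?_⟩
  · rw [Module.card_eq_pow_finrank (K := F), hK]
  · refine ⟨p, h, hp, hh, ?_, hF⟩
    have := Fact.mk hp
    have : CharP F p := charP_of_card_eq_prime_pow hF
    exact charP_of_injective_algebraMap (algebraMap F K).injective p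
  · rw [Finset.card_image_of_injOn hinj, hcard]
  · obtain ⟨d, hd⟩ := exists_pow_card_eq_mul_imp_mem_span (F := F) w
    by_cases hd0 : d = 0
    · refine le_trans (Finset.card_le_one.2 fun b hb c hc => ?_) hn.le
      have key : ∀ b, (b - z) ^ Fintype.card F = w * (b - z) → b = z := fun b hb => by
        have := hd _ hb
        rw [hd0, Submodule.span_zero_singleton, Submodule.mem_bot] at this
        exact sub_eq_zero.1 this
      rw [key b (Finset.mem_filter.1 hb).2, key c (Finset.mem_filter.1 hc).2]
    let g : V →ₗ[F] K :=
      LinearMap.snd F F K ∘ₗ e.toLinearMap -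
        (LinearMap.toSpanSingleton F K z) ∘ₗ LinearMap.fst F F K ∘ₗ e.toLinearMap
    have hg : ∀ x, g x = (e x).2 - (e x).1 • z := fun x => rfl
    let M := LinearMap.ker ((Submodule.span F {d}).mkQ ∘ₗ g)
    have hM : ∀ x, x ∈ M ↔ g x ∈ Submodule.span F {d} := fun x => by
      simp [M]
    have hM2 : finrank F M = 2 := by
      have h1 := LinearMap.finrank_range_add_finrank_ker ((Submodule.span F {d}).mkQ ∘ₗ g)
      have h2 : Function.Surjective ((Submodule.span F {d}).mkQ ∘ₗ g) := by
        rw [LinearMap.coe_comp]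
        refine (Submodule.mkQ_surjective _).comp fun k => ⟨e.symm (0, k), ?_⟩
        simp [hg]
      have : FiniteDimensional F K := .of_finrank_pos (by omega)
      have h3 := Submodule.finrank_quotient_add_finrank (Submodule.span F {d})
      rw [LinearMap.range_eq_top.2 h2, finrank_top] at h1
      rw [finrank_span_singleton hd0] at h3
      change _ + finrank F M = _ at h1
      omega
    have h1 := hline M hM2
    refine le_trans ?_ h1
    rw [Finset.filter_image]
    refine Finset.card_image_le.trans ?_
    rw [← Set.ncard_coe_finset]
    refine Set.ncard_le_ncard (fun P hP => ?_) (Set.toFinite _)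
    rw [Finset.mem_coe, Finset.mem_filter] at hP
    refine ⟨hP.1, ?_⟩
    rw [hspan P hP.1, Submodule.span_singleton_le_iff_mem, hM, hg, hv P hP.1, one_smul]
    exact hd _ hP.2

end ProjectivePlane

end MaximalArc

/-- Ball–Blokhuis–Mazzocca, 1996 (with Cossu, Thas): `PG(2,q)`, `q` odd, has no
maximal arcs: no `((n-1)(q+1)+1, n)`-arc exists for `1 < n < q`. -/
theorem no_maximal_arcs_odd (p h : ℕ) (hp : p.Prime) (hodd : Odd p) (hh : 0 < h)
    (F : Type) [Field F] [Fintype F] (hF : Fintype.card F = p ^ h) :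
    ∀ n : ℕ, 1 < n → n < p ^ h →
      ∀ B : Set (Submodule F (Fin 3 → F)),
        (∀ P ∈ B, finrank F P = 1) →
        (∀ L : Submodule F (Fin 3 → F), finrank F L = 2 →
          Set.ncard {P ∈ B | P ≤ L} ≤ n) →
        B.ncard ≠ (n - 1) * (p ^ h + 1) + 1 := by
  classical
  intro n hn hnq B hB hline hcard
  have := Fact.mk hp
  have : CharP F p := charP_of_card_eq_prime_pow hF
  let := Fintype.ofFinite (FiniteField.Extension F p 2)
  rw [← hF] at hnq hcard
  obtain ⟨S, hS⟩ := MaximalArc.exists_isAffineMaximalArc (K := FiniteField.Extension F p 2)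
    hp hh hF (FiniteField.finrank_extension F p 2) (by simp) hn hnq (Set.toFinite B).toFinset
    (by simpa using hB) (by simpa using hline) (by rw [← hcard, Set.ncard_eq_toFinset_card])
  exact hS.not_odd (hF ▸ hodd.pow)
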